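/- Iterated leave-one-out trajectory divergence bound: assume each per-sample loss ℓ i is differentiable with ‖∇ℓᵢ(θ)‖ ≤ g for all θ, the full-batch gradient map ∇L is K-Lipschitz with K > 0, and 0 ≤ η t ≤ 1 for all t. Then for every T, ‖θ₋ⱼ^T − θ^T‖ ≤ (2g/(N−1)) · ((1 + K)^T − 1)/K. -/

import Mathlib

theorem gradient_const_mul_sum {F ι : Type*} [NormedAddCommGroup F] [InnerProductSpace ℝ F]
    [CompleteSpace F] {f : ι → F → ℝ} (hf : ∀ i, Differentiable ℝ (f i)) (c : ℝ)
    (s : Finset ι) (x : F) :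
    gradient (fun z => c * ∑ i ∈ s, f i z) x = c • ∑ i ∈ s, gradient (f i) x := by
  have hs : HasFDerivAt (fun z => c * ∑ i ∈ s, f i z) (c • ∑ i ∈ s, fderiv ℝ (f i) x) x :=
    (HasFDerivAt.fun_sum fun i _ => (hf i x).hasFDerivAt).const_mul c
  simp [gradient, hs.fderiv]

/-- A leave-one-out mean differs from the full mean of `n ≥ 2` vectors of norm at most `g`
by at most `2 * g / (n - 1)`. -/
theorem norm_leave_one_out_mean_sub_mean_le {E : Type*} [NormedAddCommGroup E] [NormedSpace ℝ E]
    {n : ℕ} (hn : 2 ≤ n) (v : Fin n → E) (j : Fin n) {g : ℝ} (hv : ∀ i, ‖v i‖ ≤ g) :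
    ‖(1 / ((n : ℝ) - 1)) • ∑ i ∈ Finset.univ.filter (fun i => i ≠ j), v i
      - (1 / (n : ℝ)) • ∑ i, v i‖ ≤ 2 * g / ((n : ℝ) - 1) := by
  have hn' : (2 : ℝ) ≤ n := by exact_mod_cast hn
  have hn0 : (n : ℝ) ≠ 0 := by linarith
  have hn1 : 0 < (n : ℝ) - 1 := by linarith
  have hsum : ∑ i ∈ Finset.univ.filter (fun i => i ≠ j), v i = ∑ i, v i - v j := by
    rw [Finset.filter_ne', eq_sub_iff_add_eq, Finset.sum_erase_add _ _ (Finset.mem_univ j)]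
  have hmean : ‖(1 / (n : ℝ)) • ∑ i, v i‖ ≤ g := by
    have h : ‖∑ i, v i‖ ≤ n * g := by
      simpa using norm_sum_le_of_le Finset.univ fun i _ => hv i
    rw [norm_smul, Real.norm_of_nonneg (by positivity), one_div, inv_mul_le_iff₀ (by linarith)]
    exact h
  have hdiff : (1 / ((n : ℝ) - 1)) • ∑ i ∈ Finset.univ.filter (fun i => i ≠ j), v i
      - (1 / (n : ℝ)) • ∑ i, v i
      = (1 / ((n : ℝ) - 1)) • ((1 / (n : ℝ)) • ∑ i, v i - v j) := by
    rw [hsum]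
    match_scalars <;> field_simp
    ring
  rw [hdiff, norm_smul, Real.norm_of_nonneg (by positivity), one_div, div_eq_inv_mul (2 * g)]
  gcongr
  linarith [norm_sub_le ((1 / (n : ℝ)) • ∑ i, v i) (v j), hv j]

/-- A discrete Grönwall inequality with constant coefficients. -/
theorem le_geometric_of_le_one_add_mul_add {d : ℕ → ℝ} {K c : ℝ} (hK : 0 < K) (h0 : d 0 ≤ 0)
    (hd : ∀ t, d (t + 1) ≤ (1 + K) * d t + c) (T : ℕ) :
    d T ≤ c * ((1 + K) ^ T - 1) / K := by
  induction T with
  | zero => simpa using h0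
  | succ t ih =>
    calc d (t + 1) ≤ (1 + K) * d t + c := hd t
      _ ≤ (1 + K) * (c * ((1 + K) ^ t - 1) / K) + c := by gcongr
      _ = c * ((1 + K) ^ (t + 1) - 1) / K := by
        field_simp
        ring

/-- Iterated leave-one-out trajectory divergence bound: with uniformly bounded sample
gradients (`g`), a `K`-Lipschitz full-batch gradient map (`K > 0`), and step sizes
`0 ≤ η t ≤ 1`, for every `T`,
`‖θ₋ⱼ^T − θ^T‖ ≤ (2g/(N−1)) · ((1 + K)^T − 1)/K`. -/
theorem loo_trajectory_divergence_bound
    (p N : ℕ) (hN : 2 ≤ N)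
    (ℓ : Fin N → EuclideanSpace ℝ (Fin p) → ℝ) (j : Fin N)
    (g K : ℝ) (hK : 0 < K)
    (η : ℕ → ℝ) (hη : ∀ t, 0 ≤ η t ∧ η t ≤ 1)
    (hdiff : ∀ i, Differentiable ℝ (ℓ i))
    (hbound : ∀ i (x : EuclideanSpace ℝ (Fin p)), ‖gradient (ℓ i) x‖ ≤ g)
    (hlip : ∀ x y : EuclideanSpace ℝ (Fin p),
      ‖gradient (fun z => (1 / (N : ℝ)) * ∑ i, ℓ i z) x -
          gradient (fun z => (1 / (N : ℝ)) * ∑ i, ℓ i z) y‖ ≤ K * ‖x - y‖)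
    (θ θmj : ℕ → EuclideanSpace ℝ (Fin p))
    (hθ : ∀ t, θ (t + 1) =
      θ t - η t • gradient (fun x => (1 / (N : ℝ)) * ∑ i, ℓ i x) (θ t))
    (hθmj : ∀ t, θmj (t + 1) =
      θmj t - η t • gradient
        (fun x => (1 / ((N : ℝ) - 1)) *
          ∑ i ∈ Finset.univ.filter (fun i => i ≠ j), ℓ i x) (θmj t))
    (hinit : θmj 0 = θ 0) (T : ℕ) :
    ‖θmj T - θ T‖ ≤ (2 * g / ((N : ℝ) - 1)) * ((1 + K) ^ T - 1) / K := by
  have hpert : ∀ x, ‖gradient (fun z => (1 / ((N : ℝ) - 1)) *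
      ∑ i ∈ Finset.univ.filter (fun i => i ≠ j), ℓ i z) x
      - gradient (fun z => (1 / (N : ℝ)) * ∑ i, ℓ i z) x‖ ≤ 2 * g / ((N : ℝ) - 1) := by
    intro x
    rw [gradient_const_mul_sum hdiff, gradient_const_mul_sum hdiff]
    exact norm_leave_one_out_mean_sub_mean_le hN _ j fun i => hbound i x
  refine le_geometric_of_le_one_add_mul_add (d := fun t => ‖θmj t - θ t‖) hK
    (by simp [hinit]) (fun t => ?_) T
  simp only [hθ, hθmj]
  have hpert_t := hpert (θmj t)
  have hlip_t := hlip (θmj t) (θ t)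
  set A := gradient (fun z => (1 / ((N : ℝ) - 1)) *
    ∑ i ∈ Finset.univ.filter (fun i => i ≠ j), ℓ i z) (θmj t)
  set B := gradient (fun z => (1 / (N : ℝ)) * ∑ i, ℓ i z) (θmj t)
  set C := gradient (fun z => (1 / (N : ℝ)) * ∑ i, ℓ i z) (θ t)
  have hη_le : ‖η t • (A - C)‖ ≤ ‖A - C‖ := by
    rw [norm_smul, Real.norm_of_nonneg (hη t).1]
    exact mul_le_of_le_one_left (norm_nonneg _) (hη t).2
  calc ‖θmj t - η t • A - (θ t - η t • C)‖
      = ‖(θmj t - θ t) - η t • (A - C)‖ := by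
        congr 1
        module
    _ ≤ ‖θmj t - θ t‖ + ‖A - C‖ := (norm_sub_le _ _).trans (by gcongr)
    _ ≤ ‖θmj t - θ t‖ + (‖A - B‖ + ‖B - C‖) := by
        gcongr
        exact norm_sub_le_norm_sub_add_norm_sub A B C
    _ ≤ (1 + K) * ‖θmj t - θ t‖ + 2 * g / ((N : ℝ) - 1) := by linarith
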